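/- arXiv:1303.2001 — 3 statements merged into one kernel-verified Lean document; each statement's English description precedes it below -/
import Mathlib

section
/- Under the standing hypotheses, the functor E ↦ Q_χ ⊗_{W_ε^s(G)} E is an equivalence from the category of finite-dimensional left W_ε^s(G)-modules to the category of finite-dimensional left U_ξ(𝔤)-modules, with inverse equivalence V ↦ V_χ; in particular the functor V ↦ V_χ is exact, and every finite-dimensional U_ξ(𝔤)-module is generated by its Whittaker vectors. -/
/-- A finite-dimensional algebra `A` over `R` is Frobenius iff it carries a
non-degenerate associative bilinear form. -/
def IsFrobeniusAlgebra (R A : Type*) [CommRing R] [Ring A] [Algebra R A] : Prop :=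
  ∃ B : A →ₗ[R] A →ₗ[R] R,
    (∀ a b c : A, B (a * b) c = B a (b * c)) ∧
    (∀ a : A, (∀ b : A, B a b = 0) → a = 0) ∧
    (∀ b : A, (∀ a : A, B a b = 0) → b = 0)

/-- The left ideal of `A` generated by the elements `y − χ(y)`, `y ∈ M`, so that
`Q_χ = A ⊗_{M} ℂ_χ = A / whIdeal A M χ` is the induced (Whittaker) module. -/
def whIdeal (A : Type*) [Ring A] [Algebra ℂ A] (M : Subalgebra ℂ A) (χ : M →ₐ[ℂ] ℂ) :
    Ideal A :=
  Ideal.span {x : A | ∃ y : M, x = (y : A) - algebraMap ℂ A (χ y)}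

section WhModule

variable {A : Type*} [Ring A] {Q : Type*} [AddCommGroup Q] [Module A Q]
variable {V V' : Type*} [AddCommGroup V] [Module A V] [AddCommGroup V'] [Module A V']

/-- The `W = End_A(Q)^{opp}`-module structure on `V_χ = Hom_A(Q, V)`, given by
precomposition. -/
instance endOppSMul : SMul (Module.End A Q)ᵐᵒᵖ (Q →ₗ[A] V) :=
  ⟨fun w φ => φ ∘ₗ w.unop⟩

instance endOppModule : Module (Module.End A Q)ᵐᵒᵖ (Q →ₗ[A] V) where
  one_smul φ := LinearMap.ext fun _ => rfl
  mul_smul _ _ _ := LinearMap.ext fun _ => rfl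
  smul_zero _ := LinearMap.ext fun _ => rfl
  smul_add _ _ _ := LinearMap.ext fun _ => rfl
  add_smul _ _ φ := LinearMap.ext fun _ => φ.map_add _ _
  zero_smul φ := LinearMap.ext fun _ => φ.map_zero

/-- The `W`-linear map `V_χ = Hom_A(Q,V) → Hom_A(Q,V') = V'_χ` induced by an
`A`-module map `φ : V → V'`; this is the action of the functor `V ↦ V_χ` on morphisms. -/
def whMap (φ : V →ₗ[A] V') :
    (Q →ₗ[A] V) →ₗ[(Module.End A Q)ᵐᵒᵖ] (Q →ₗ[A] V') where
  toFun ψ := φ ∘ₗ ψ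
  map_add' ψ ψ' := LinearMap.ext fun _ => φ.map_add _ _
  map_smul' _ _ := rfl

end WhModule

/-- A finite-dimensional module over the finite-dimensional `ℂ`-algebra `A`. -/
structure FinDimRep (A : Type*) [Ring A] [Algebra ℂ A] where
  V : Type
  [addCommGroup : AddCommGroup V]
  [modC : Module ℂ V]
  [modA : Module A V]
  [tower : IsScalarTower ℂ A V]
  [findim : FiniteDimensional ℂ V]

attribute [instance] FinDimRep.addCommGroup FinDimRep.modC FinDimRep.modA FinDimRep.tower FinDimRep.findim

section WhittakerVectors

variable {A : Type*} [Ring A] [Algebra ℂ A] (M : Subalgebra ℂ A) (χ : M →ₐ[ℂ] ℂ)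

/-- The space of Whittaker vectors of `V`. -/
def whVectors (V : Type*) [AddCommGroup V] [Module ℂ V] [Module A V] [IsScalarTower ℂ A V] :
    Submodule ℂ V where
  carrier := {v | ∀ x : M, (x : A) • v = χ x • v}
  add_mem' hv hw x := by rw [smul_add, smul_add, hv x, hw x]
  zero_mem' x := by rw [smul_zero, smul_zero]
  smul_mem' c v hv x := by rw [smul_comm (x : A) c v, hv x, smul_comm]

/-- `V` has a finite basis over the subalgebra `M`. -/
def HasFiniteBasisOver (V : Type*) [AddCommGroup V] [Module A V] : Prop :=
  ∃ (n : ℕ) (v : Fin n → V),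
    (∀ w : V, ∃ cf : Fin n → A, (∀ p, cf p ∈ M) ∧ w = ∑ p, cf p • v p) ∧
    (∀ cf : Fin n → A, (∀ p, cf p ∈ M) → (∑ p, cf p • v p) = 0 → ∀ p, cf p = 0)

variable {M} in
/-- For modules free over `M`, the dimension of the space of Whittaker vectors is proportional
to the dimension of the module. -/
lemma finrank_whVectors_mul [FiniteDimensional ℂ A] {V : Type*} [AddCommGroup V] [Module ℂ V]
    [Module A V] [IsScalarTower ℂ A V] (hV : HasFiniteBasisOver M V) :
    Module.finrank ℂ (whVectors M χ V) * Module.finrank ℂ M =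
      Module.finrank ℂ (whVectors M χ A ⊓ Subalgebra.toSubmodule M : Submodule ℂ A) *
        Module.finrank ℂ V := by
  obtain ⟨n, v, hspan, hind⟩ := hV
  let comb : (Fin n → A) →ₗ[ℂ] V :=
    ∑ p, ((LinearMap.toSpanSingleton A V (v p)).restrictScalars ℂ) ∘ₗ LinearMap.proj p
  have hcomb (cf : Fin n → A) : comb cf = ∑ p, cf p • v p := by simp [comb]
  have hinj (cf cf' : Fin n → A) (h : ∀ p, cf p ∈ M) (h' : ∀ p, cf' p ∈ M)
      (heq : comb cf = comb cf') : cf = cf' := by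
    rw [hcomb, hcomb, ← sub_eq_zero, ← Finset.sum_sub_distrib] at heq
    simp only [← sub_smul] at heq
    funext p
    exact sub_eq_zero.mp (hind (fun p => cf p - cf' p) (fun p => M.sub_mem (h p) (h' p)) heq p)
  let incl (N : Submodule ℂ A) : (Fin n → N) →ₗ[ℂ] (Fin n → A) :=
    LinearMap.pi fun p => N.subtype ∘ₗ LinearMap.proj p
  have hincl (N : Submodule ℂ A) (cf : Fin n → N) (p : Fin n) : incl N cf p = cf p := rfl
  have finrank_eq (N : Submodule ℂ A) (hN : N ≤ Subalgebra.toSubmodule M) (U : Submodule ℂ V)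
      (hU : ∀ cf : Fin n → A, (∀ p, cf p ∈ M) → ((∀ p, cf p ∈ N) ↔ comb cf ∈ U)) :
      n * Module.finrank ℂ N = Module.finrank ℂ U := by
    let F : (Fin n → N) →ₗ[ℂ] U := (comb ∘ₗ incl N).codRestrict U fun cf =>
      (hU _ fun p => hN (cf p).2).mp fun p => (cf p).2
    have hF : Function.Bijective F := by
      constructor
      · intro a b hab
        have := hinj (incl N a) (incl N b) (fun p => hN (a p).2) (fun p => hN (b p).2)
          (congrArg Subtype.val hab)
        funext p
        exact Subtype.ext (congrFun this p)
      · intro u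
        obtain ⟨cf, hcf, hu⟩ := hspan u
        rw [← hcomb] at hu
        have hmem := (hU cf hcf).mpr (hu ▸ u.2)
        exact ⟨fun p => ⟨cf p, hmem p⟩, Subtype.ext hu.symm⟩
    rw [← (LinearEquiv.ofBijective F hF).finrank_eq, Module.finrank_pi_fintype]
    simp
  have hwh := finrank_eq (whVectors M χ A ⊓ Subalgebra.toSubmodule M) inf_le_right
    (whVectors M χ V) fun cf hcf => by
      constructor
      · intro h x
        rw [hcomb, Finset.smul_sum, Finset.smul_sum]
        refine Finset.sum_congr rfl fun p _ => ?_
        rw [← smul_assoc, (h p).1 x, smul_assoc]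
      · intro h p
        refine ⟨fun x => ?_, hcf p⟩
        have hx := h x
        refine congrFun (hinj (fun p => (x : A) • cf p) (fun p => χ x • cf p)
          (fun p => M.mul_mem x.2 (hcf p)) (fun p => M.smul_mem (hcf p) _) ?_) p
        rw [hcomb, Finset.smul_sum, Finset.smul_sum] at hx
        rw [hcomb, hcomb]
        simpa only [smul_assoc] using hx
  have htop := finrank_eq (Subalgebra.toSubmodule M) le_rfl ⊤ fun cf hcf =>
    ⟨fun _ => Submodule.mem_top, fun _ => hcf⟩
  rw [finrank_top] at htop
  rw [← hwh, ← htop]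
  change _ * Module.finrank ℂ (Subalgebra.toSubmodule M) = _
  ring

variable {M} in
/-- Whittaker vectors lift along surjections of finite-dimensional modules free over `M`. -/
lemma exists_whVectors_lift [FiniteDimensional ℂ A] {V V' : Type*} [AddCommGroup V] [Module ℂ V]
    [Module A V] [IsScalarTower ℂ A V] [FiniteDimensional ℂ V] [AddCommGroup V'] [Module ℂ V']
    [Module A V'] [IsScalarTower ℂ A V'] [FiniteDimensional ℂ V'] (φ : V →ₗ[A] V')
    (hφ : Function.Surjective φ) (hV : HasFiniteBasisOver M V) (hV' : HasFiniteBasisOver M V')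
    (hK : HasFiniteBasisOver M (LinearMap.ker φ)) {w : V'} (hw : w ∈ whVectors M χ V') :
    ∃ v ∈ whVectors M χ V, φ v = w := by
  let φ' : V →ₗ[ℂ] V' := φ.restrictScalars ℂ
  let F : whVectors M χ V →ₗ[ℂ] whVectors M χ V' :=
    φ'.restrict fun v hv x => by
      change (x : A) • φ v = χ x • φ' v
      rw [← φ.map_smul, hv x, ← φ'.map_smul]; rfl
  let e : LinearMap.ker F ≃ₗ[ℂ] whVectors M χ (LinearMap.ker φ) :=
    { toFun u := ⟨⟨u.1.1, congrArg Subtype.val u.2⟩, fun x => Subtype.ext (u.1.2 x)⟩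
      invFun u := ⟨⟨u.1.1, fun x => congrArg Subtype.val (u.2 x)⟩, Subtype.ext u.1.2⟩
      map_add' _ _ := rfl
      map_smul' _ _ := rfl
      left_inv _ := rfl
      right_inv _ := rfl }
  have hkerφ : Module.finrank ℂ (LinearMap.ker φ') = Module.finrank ℂ (LinearMap.ker φ) := rfl
  have hrn := F.finrank_range_add_finrank_ker
  have hrn' := φ'.finrank_range_add_finrank_ker
  rw [LinearMap.range_eq_top.mpr (show Function.Surjective φ' from hφ), finrank_top, hkerφ] at hrn'
  rw [e.finrank_eq] at hrn
  have dV := finrank_whVectors_mul χ hV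
  have dV' := finrank_whVectors_mul χ hV'
  have dK := finrank_whVectors_mul χ hK
  have : Nontrivial M := χ.toRingHom.domain_nontrivial
  have : FiniteDimensional ℂ M :=
    inferInstanceAs (FiniteDimensional ℂ (Subalgebra.toSubmodule M))
  have hpos : 0 < Module.finrank ℂ M := Module.finrank_pos
  have hrange : Module.finrank ℂ (LinearMap.range F) = Module.finrank ℂ (whVectors M χ V') := by
    apply Nat.eq_of_mul_eq_mul_right hpos
    rw [← hrn, ← hrn', add_mul, mul_add] at dV
    omega
  obtain ⟨v, hv⟩ := LinearMap.range_eq_top.mp (Submodule.eq_top_of_finrank_eq hrange) ⟨w, hw⟩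
  exact ⟨v, v.2, congrArg Subtype.val hv⟩

/-- The canonical generator of `Q_χ` is a Whittaker vector. -/
lemma mk_one_mem_whVectors :
    (Submodule.Quotient.mk 1 : A ⧸ whIdeal A M χ) ∈ whVectors M χ (A ⧸ whIdeal A M χ) := by
  intro x
  rw [← Submodule.Quotient.mk_smul, ← Submodule.Quotient.mk_smul, Submodule.Quotient.eq]
  refine Ideal.subset_span ⟨x, ?_⟩
  rw [smul_eq_mul, mul_one, Algebra.algebraMap_eq_smul_one]

variable {M χ} in
/-- The universal property of `Q_χ`: a Whittaker vector `v` gives a map `Q_χ → V`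
sending the canonical generator to `v`. -/
lemma exists_hom_of_mem_whVectors {V : Type*} [AddCommGroup V] [Module ℂ V] [Module A V]
    [IsScalarTower ℂ A V] {v : V} (hv : v ∈ whVectors M χ V) :
    ∃ ψ : (A ⧸ whIdeal A M χ) →ₗ[A] V, ψ (Submodule.Quotient.mk 1) = v := by
  refine ⟨(whIdeal A M χ).liftQ (LinearMap.toSpanSingleton A V v) ?_, ?_⟩
  · refine Ideal.span_le.mpr ?_
    rintro _ ⟨y, rfl⟩
    simp only [SetLike.mem_coe, LinearMap.mem_ker, LinearMap.toSpanSingleton_apply, sub_smul,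
      algebraMap_smul]
    exact sub_eq_zero.mpr (hv y)
  · exact one_smul A v

variable {M χ} in
lemma hom_mk_one_mem_whVectors {V : Type*} [AddCommGroup V] [Module ℂ V] [Module A V]
    [IsScalarTower ℂ A V] (ψ : (A ⧸ whIdeal A M χ) →ₗ[A] V) :
    ψ (Submodule.Quotient.mk 1) ∈ whVectors M χ V := by
  intro x
  rw [← ψ.map_smul, mk_one_mem_whVectors M χ x, ← algebraMap_smul A (χ x), ψ.map_smul,
    algebraMap_smul]

variable {M χ} in
lemma hom_ext_mk_one {V : Type*} [AddCommGroup V] [Module A V]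
    {ψ ψ' : (A ⧸ whIdeal A M χ) →ₗ[A] V}
    (h : ψ (Submodule.Quotient.mk 1) = ψ' (Submodule.Quotient.mk 1)) : ψ = ψ' := by
  refine Submodule.linearMap_qext _ (LinearMap.ext_ring ?_)
  simpa using h

end WhittakerVectors

section Morita

variable {A : Type*} [Ring A] {Q : Type*} [AddCommGroup Q] [Module A Q]

/-- The rank one endomorphism `x ↦ ψ(x) • q` of `Q`. -/
def rankOneEnd (ψ : Q →ₗ[A] A) (q : Q) : Module.End A Q :=
  (LinearMap.toSpanSingleton A Q q) ∘ₗ ψ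

@[simp]
lemma rankOneEnd_apply (ψ : Q →ₗ[A] A) (q x : Q) : rankOneEnd ψ q x = ψ x • q := rfl

/-- The map `x ↦ ψ(x) • v`. -/
def homSMul {V : Type*} [AddCommGroup V] [Module A V] (ψ : Q →ₗ[A] A) (v : V) : Q →ₗ[A] V :=
  (LinearMap.toSpanSingleton A V v) ∘ₗ ψ

@[simp]
lemma homSMul_apply {V : Type*} [AddCommGroup V] [Module A V] (ψ : Q →ₗ[A] A) (v : V) (x : Q) :
    homSMul ψ v x = ψ x • v := rfl

lemma endOpp_smul_def {V : Type*} [AddCommGroup V] [Module A V] (w : Module.End A Q)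
    (φ : Q →ₗ[A] V) : MulOpposite.op w • φ = φ ∘ₗ w := rfl

@[simp]
lemma whMap_apply {V V' : Type*} [AddCommGroup V] [Module A V] [AddCommGroup V'] [Module A V']
    (φ : V →ₗ[A] V') (ψ : Q →ₗ[A] V) : whMap φ ψ = φ ∘ₗ ψ := rfl

/-- If the trace ideal of `Q` contains `1`, then `Hom_A(Q, -)` is full. -/
lemma whMap_surjective_of_sum_eq_one {n : ℕ} {ψ : Fin n → Q →ₗ[A] A} {q : Fin n → Q}
    (h : ∑ i, ψ i (q i) = 1) {V V' : Type*} [AddCommGroup V] [Module A V] [AddCommGroup V']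
    [Module A V'] (T : (Q →ₗ[A] V) →ₗ[(Module.End A Q)ᵐᵒᵖ] (Q →ₗ[A] V')) :
    ∃ φ : V →ₗ[A] V', whMap φ = T := by
  have hT (θ : Q →ₗ[A] V) (w : Module.End A Q) (x : Q) : T (θ ∘ₗ w) x = T θ (w x) := by
    rw [← endOpp_smul_def, T.map_smul]; rfl
  refine ⟨{ toFun v := ∑ i, T (homSMul (ψ i) v) (q i), map_add' := ?_, map_smul' := ?_ }, ?_⟩
  · intro v w
    have (i : Fin n) : homSMul (ψ i) (v + w) = homSMul (ψ i) v + homSMul (ψ i) w := by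
      ext; simp
    simp [this, Finset.sum_add_distrib]
  · intro a v
    have key (i : Fin n) : homSMul (ψ i) (a • v) =
        ∑ j, homSMul (ψ j) v ∘ₗ rankOneEnd (ψ i) (a • q j) := by
      ext x
      have hv : ∑ j, ψ j (q j) • v = v := by rw [← Finset.sum_smul, h, one_smul]
      simp [LinearMap.sum_apply, ← Finset.smul_sum, hv]
    simp only [key, map_sum, LinearMap.sum_apply, hT, rankOneEnd_apply, RingHom.id_apply]
    rw [Finset.sum_comm, Finset.smul_sum]
    refine Finset.sum_congr rfl fun j _ => ?_
    simp only [map_smul]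
    rw [← Finset.sum_smul, h, one_smul]
  · ext θ x
    have key (i : Fin n) : homSMul (ψ i) (θ x) = θ ∘ₗ rankOneEnd (ψ i) x := by
      ext y; simp
    simp only [whMap_apply, LinearMap.comp_apply, LinearMap.coe_mk, AddHom.coe_mk, key, hT,
      rankOneEnd_apply, map_smul]
    rw [← Finset.sum_smul, h, one_smul]

variable (A Q) in
/-- The `A`-module `Hom_W(Hom_A(Q, A), E)`, `W = End_A(Q)^{opp}`; for a progenerator `Q` it is
isomorphic to `Q ⊗_W E`. -/
def WhCoinduced (E : Type*) [AddCommGroup E] [Module (Module.End A Q)ᵐᵒᵖ E] : Type _ :=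
  (Q →ₗ[A] A) →ₗ[(Module.End A Q)ᵐᵒᵖ] E

namespace WhCoinduced

variable {E : Type*} [AddCommGroup E] [Module (Module.End A Q)ᵐᵒᵖ E]

instance : AddCommGroup (WhCoinduced A Q E) :=
  inferInstanceAs (AddCommGroup ((Q →ₗ[A] A) →ₗ[(Module.End A Q)ᵐᵒᵖ] E))

instance : FunLike (WhCoinduced A Q E) (Q →ₗ[A] A) E :=
  inferInstanceAs (FunLike ((Q →ₗ[A] A) →ₗ[(Module.End A Q)ᵐᵒᵖ] E) _ _)

@[ext]
lemma ext {T T' : WhCoinduced A Q E} (h : ∀ ψ, T ψ = T' ψ) : T = T' := LinearMap.ext h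

lemma map_add (T : WhCoinduced A Q E) (ψ ψ' : Q →ₗ[A] A) : T (ψ + ψ') = T ψ + T ψ' :=
  LinearMap.map_add (show (Q →ₗ[A] A) →ₗ[(Module.End A Q)ᵐᵒᵖ] E from T) ψ ψ'

lemma map_zero (T : WhCoinduced A Q E) : T 0 = 0 :=
  LinearMap.map_zero (show (Q →ₗ[A] A) →ₗ[(Module.End A Q)ᵐᵒᵖ] E from T)

lemma map_sum {ι : Type*} (T : WhCoinduced A Q E) (s : Finset ι) (ψ : ι → Q →ₗ[A] A) :
    T (∑ i ∈ s, ψ i) = ∑ i ∈ s, T (ψ i) :=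
  _root_.map_sum (show (Q →ₗ[A] A) →ₗ[(Module.End A Q)ᵐᵒᵖ] E from T) ψ s

lemma map_comp (T : WhCoinduced A Q E) (ψ : Q →ₗ[A] A) (w : Module.End A Q) :
    T (ψ ∘ₗ w) = MulOpposite.op w • T ψ :=
  LinearMap.map_smul (show (Q →ₗ[A] A) →ₗ[(Module.End A Q)ᵐᵒᵖ] E from T) (MulOpposite.op w) ψ

@[simp]
lemma add_apply (T T' : WhCoinduced A Q E) (ψ : Q →ₗ[A] A) : (T + T') ψ = T ψ + T' ψ := rfl

@[simp]
lemma zero_apply (ψ : Q →ₗ[A] A) : (0 : WhCoinduced A Q E) ψ = 0 := rfl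

instance : SMul A (WhCoinduced A Q E) where
  smul a T :=
    { toFun ψ := T (homSMul ψ a)
      map_add' ψ ψ' := by
        rw [← map_add]; congr 1; ext; simp [add_mul]
      map_smul' w ψ := map_comp T (homSMul ψ a) w.unop }

@[simp]
lemma smul_apply (a : A) (T : WhCoinduced A Q E) (ψ : Q →ₗ[A] A) :
    (a • T) ψ = T (homSMul ψ a) := rfl

instance : Module A (WhCoinduced A Q E) where
  one_smul T := by
    ext ψ; rw [smul_apply]; congr 1; ext; simp
  mul_smul a b T := by
    ext ψ; simp only [smul_apply]; congr 1; ext; simp [mul_assoc]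
  smul_zero _ := rfl
  smul_add _ _ _ := rfl
  add_smul a b T := by
    ext ψ; simp only [smul_apply, add_apply]; rw [← map_add]; congr 1; ext; simp [mul_add]
  zero_smul T := by
    ext ψ; rw [smul_apply, zero_apply, ← map_zero T]; congr 1; ext; simp

/-- The unit `E → Hom_A(Q, Hom_W(Hom_A(Q, A), E))`. -/
def unit : E →ₗ[(Module.End A Q)ᵐᵒᵖ] (Q →ₗ[A] WhCoinduced A Q E) where
  toFun e :=
    { toFun q :=
        { toFun ψ := MulOpposite.op (rankOneEnd ψ q) • e
          map_add' ψ ψ' := by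
            rw [← add_smul, ← MulOpposite.op_add]; congr 2; ext; simp [add_smul]
          map_smul' w ψ := by
            rw [RingHom.id_apply, ← mul_smul]; rfl }
      map_add' q q' := by
        ext ψ
        change MulOpposite.op (rankOneEnd ψ (q + q')) • e =
          MulOpposite.op (rankOneEnd ψ q) • e + MulOpposite.op (rankOneEnd ψ q') • e
        rw [← add_smul, ← MulOpposite.op_add]; congr 2; ext; simp
      map_smul' a q := by
        ext ψ
        change MulOpposite.op (rankOneEnd ψ (a • q)) • e =
          MulOpposite.op (rankOneEnd (homSMul ψ a) q) • e
        congr 2; ext; simp [mul_smul] }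
  map_add' e e' := by
    ext q ψ
    exact smul_add _ _ _
  map_smul' w e := by
    ext q ψ
    change MulOpposite.op (rankOneEnd ψ q) • w • e =
      MulOpposite.op (rankOneEnd ψ (w.unop q)) • e
    rw [← mul_smul]
    congr 1
    refine MulOpposite.unop_injective (LinearMap.ext fun x => ?_)
    exact w.unop.map_smul _ _

lemma unit_apply (e : E) (q : Q) (ψ : Q →ₗ[A] A) :
    unit e q ψ = MulOpposite.op (rankOneEnd ψ q) • e := rfl

/-- For a cyclic projective module the unit is an isomorphism. -/
lemma unit_bijective {q₀ : Q} {s : Q →ₗ[A] A} (hs : ∀ q, s q • q₀ = q) :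
    Function.Bijective (unit : E →ₗ[(Module.End A Q)ᵐᵒᵖ] (Q →ₗ[A] WhCoinduced A Q E)) := by
  have hone : rankOneEnd s q₀ = 1 := LinearMap.ext hs
  constructor
  · intro e e' h
    have := congrArg (fun F : Q →ₗ[A] WhCoinduced A Q E => F q₀ s) h
    simpa only [unit_apply, hone, MulOpposite.op_one, one_smul] using this
  · intro F
    refine ⟨F q₀ s, ?_⟩
    ext q ψ
    rw [unit_apply, ← map_comp]
    conv_rhs => rw [← hs q, F.map_smul, smul_apply]
    congr 1
    ext x
    simp

end WhCoinduced

/-- The finite-dimensional module `Hom_W(Hom_A(Q, A), E)` realising a finite `W`-module `E`. -/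
lemma exists_finDimRep_equiv {A Q E : Type} [Ring A] [Algebra ℂ A] [AddCommGroup Q] [Module A Q]
    [Module ℂ Q] [IsScalarTower ℂ A Q] [FiniteDimensional ℂ Q] [AddCommGroup E]
    [Module (Module.End A Q)ᵐᵒᵖ E] [Module.Finite (Module.End A Q)ᵐᵒᵖ E]
    {q₀ : Q} {s : Q →ₗ[A] A} (hs : ∀ q, s q • q₀ = q)
    {n : ℕ} {ψ : Fin n → Q →ₗ[A] A} {q : Fin n → Q} (h : ∑ i, ψ i (q i) = 1) :
    ∃ X : FinDimRep A, Nonempty (E ≃ₗ[(Module.End A Q)ᵐᵒᵖ] (Q →ₗ[A] X.V)) := by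
  let evalGen : Module.End A Q →ₗ[ℂ] Q :=
    { toFun w := w q₀, map_add' _ _ := rfl, map_smul' _ _ := rfl }
  have hinj : Function.Injective evalGen := fun w w' hw => by
    refine LinearMap.ext fun x => ?_
    rw [← hs x, w.map_smul, w'.map_smul]
    exact congrArg (s x • ·) hw
  have : FiniteDimensional ℂ (Module.End A Q) := Module.Finite.of_injective evalGen hinj
  have : FiniteDimensional ℂ (Module.End A Q)ᵐᵒᵖ :=
    Module.Finite.equiv (MulOpposite.opLinearEquiv ℂ)
  let : Module ℂ E := Module.compHom E (algebraMap ℂ (Module.End A Q)ᵐᵒᵖ)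
  have : IsScalarTower ℂ (Module.End A Q)ᵐᵒᵖ E := .of_algebraMap_smul fun _ _ => rfl
  have : FiniteDimensional ℂ E := Module.Finite.trans (Module.End A Q)ᵐᵒᵖ E
  let : Module ℂ (WhCoinduced A Q E) := Module.compHom _ (algebraMap ℂ A)
  have : IsScalarTower ℂ A (WhCoinduced A Q E) := .of_algebraMap_smul fun _ _ => rfl
  let evalDual : WhCoinduced A Q E →ₗ[ℂ] (Fin n → E) :=
    { toFun T i := T (ψ i)
      map_add' _ _ := rfl
      map_smul' c T := by
        funext i
        change T (homSMul (ψ i) (algebraMap ℂ A c)) =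
          MulOpposite.op (algebraMap ℂ (Module.End A Q) c) • T (ψ i)
        rw [← WhCoinduced.map_comp]
        congr 1
        ext x
        simp only [homSMul_apply, LinearMap.comp_apply, Module.algebraMap_end_apply]
        rw [← algebraMap_smul A c x, (ψ i).map_smul, smul_eq_mul, smul_eq_mul,
          Algebra.commutes] }
  have hdual : Function.Injective evalDual := fun T T' hT => by
    ext θ
    have key : θ = ∑ i, ψ i ∘ₗ rankOneEnd θ (q i) := by
      ext x
      simp [LinearMap.sum_apply, ← Finset.mul_sum, h]
    rw [key, WhCoinduced.map_sum, WhCoinduced.map_sum]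
    refine Finset.sum_congr rfl fun i _ => ?_
    rw [WhCoinduced.map_comp, WhCoinduced.map_comp]
    exact congrArg _ (congrFun hT i)
  have : FiniteDimensional ℂ (WhCoinduced A Q E) := Module.Finite.of_injective evalDual hdual
  exact ⟨⟨WhCoinduced A Q E⟩,
    ⟨LinearEquiv.ofBijective WhCoinduced.unit (WhCoinduced.unit_bijective hs)⟩⟩

end Morita

/-- **Theorem 10.1 (Skryabin-type equivalence for quantum groups at roots of unity).**
Standing hypotheses: `ξ = g̃η ∈ Spec(Z_0)` with `φ∘π̃(ξ) ∈ μ_{M_+}^{-1}(u)`, all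
`t_i ≠ 0`, and the conditions of the main freeness theorem hold; `A = U_ξ(𝔤)` is the
corresponding finite-dimensional quotient of the quantum group, `M = U_ξ(𝔪_−)` the
Frobenius subalgebra generated by the root vectors `f_β`, `β ∈ Δ_{𝔪_+}` (with
`f_{γ_i}^m = d_i ≠ 0` and `f_β^m = 0` otherwise), over which every finite-dimensional
`U_ξ(𝔤)`-module is free and whose character `χ` admits a nonzero Whittaker vector in
every nonzero finite-dimensional module; `Q_χ = U_ξ(𝔤) ⊗_{U_ξ(𝔪_−)} ℂ_χ` is the induced
module and `W_ε^s(G) = End_{U_ξ(𝔤)}(Q_χ)^{opp}` the q-W algebra, acting on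
`V_χ = Hom_{U_ξ(𝔪_−)}(ℂ_χ, V) = Hom_{U_ξ(𝔤)}(Q_χ, V)` by composition.  Then the functor
`E ↦ Q_χ ⊗_{W_ε^s(G)} E` is an equivalence from finite-dimensional `W_ε^s(G)`-modules to
finite-dimensional `U_ξ(𝔤)`-modules with inverse `V ↦ V_χ`: the inverse functor is fully
faithful and essentially surjective; in particular `V ↦ V_χ` is exact, and every
finite-dimensional `U_ξ(𝔤)`-module is generated by its Whittaker vectors. -/
theorem skryabin_equivalence
    (m : ℕ) (hmodd : Odd m) (hm1 : 1 < m) (ε : ℂ) (hε : IsPrimitiveRoot ε m)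
    (A : Type) [Ring A] [Algebra ℂ A] [FiniteDimensional ℂ A]
    (L l' : ℕ) (f : Fin L → A) (g : Fin l' → Fin L) (hginj : Function.Injective g)
    (dd : Fin l' → ℂ) (hdd : ∀ i, dd i ≠ 0)
    (hfγ : ∀ i, f (g i) ^ m = algebraMap ℂ A (dd i))
    (hf0 : ∀ k, k ∉ Set.range g → f k ^ m = 0)
    -- the character `χ` of `M = U_ξ(𝔪_−)`
    (χ : ↥(Algebra.adjoin ℂ (Set.range f)) →ₐ[ℂ] ℂ)
    (c : Fin l' → ℂ) (hc : ∀ i, c i ^ m = dd i)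
    (hχγ : ∀ i, χ ⟨f (g i), Algebra.subset_adjoin ⟨g i, rfl⟩⟩ = c i)
    (hχ0 : ∀ k, k ∉ Set.range g → χ ⟨f k, Algebra.subset_adjoin ⟨k, rfl⟩⟩ = 0)
    -- `M` is Frobenius (Proposition 8.1)
    (hfrob : IsFrobeniusAlgebra ℂ ↥(Algebra.adjoin ℂ (Set.range f)))
    -- every finite-dimensional `U_ξ(𝔤)`-module is free over `M` (Theorem 9.1)
    (hfree : ∀ (V : Type) [AddCommGroup V] [Module ℂ V] [Module A V]
      [IsScalarTower ℂ A V] [FiniteDimensional ℂ V],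
      ∃ (M' : ℕ) (v : Fin M' → V),
        (∀ w : V, ∃ cf : Fin M' → A,
          (∀ p, cf p ∈ Algebra.adjoin ℂ (Set.range f)) ∧ w = ∑ p, cf p • v p) ∧
        (∀ cf : Fin M' → A, (∀ p, cf p ∈ Algebra.adjoin ℂ (Set.range f)) →
          (∑ p, cf p • v p) = 0 → ∀ p, cf p = 0))
    -- every nonzero finite-dimensional module contains a nonzero Whittaker vector
    -- (Proposition 8.7)
    (hwhit : ∀ (V : Type) [AddCommGroup V] [Module ℂ V] [Module A V]
      [IsScalarTower ℂ A V] [FiniteDimensional ℂ V] [Nontrivial V],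
      ∃ v : V, v ≠ 0 ∧
        ∀ x : ↥(Algebra.adjoin ℂ (Set.range f)), (x : A) • v = χ x • v) :
    -- full faithfulness of `V ↦ V_χ = Hom_A(Q_χ, V)`
    (∀ (V V' : Type) [AddCommGroup V] [Module ℂ V] [Module A V] [IsScalarTower ℂ A V]
      [FiniteDimensional ℂ V] [AddCommGroup V'] [Module ℂ V'] [Module A V']
      [IsScalarTower ℂ A V'] [FiniteDimensional ℂ V'],
      Function.Bijective
        (fun φ : V →ₗ[A] V' =>
          (whMap (Q := A ⧸ whIdeal A (Algebra.adjoin ℂ (Set.range f)) χ) φ))) ∧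
    -- essential surjectivity of `V ↦ V_χ` onto finite-dimensional `W_ε^s(G)`-modules
    (∀ (E : Type) [AddCommGroup E]
      [Module (Module.End A (A ⧸ whIdeal A (Algebra.adjoin ℂ (Set.range f)) χ))ᵐᵒᵖ E],
      Module.Finite (Module.End A (A ⧸ whIdeal A (Algebra.adjoin ℂ (Set.range f)) χ))ᵐᵒᵖ E →
      ∃ X : FinDimRep A, Nonempty
        (E ≃ₗ[(Module.End A (A ⧸ whIdeal A (Algebra.adjoin ℂ (Set.range f)) χ))ᵐᵒᵖ]
          ((A ⧸ whIdeal A (Algebra.adjoin ℂ (Set.range f)) χ) →ₗ[A] X.V))) ∧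
    -- exactness of `V ↦ V_χ`
    (∀ (V V' : Type) [AddCommGroup V] [Module ℂ V] [Module A V] [IsScalarTower ℂ A V]
      [FiniteDimensional ℂ V] [AddCommGroup V'] [Module ℂ V'] [Module A V']
      [IsScalarTower ℂ A V'] [FiniteDimensional ℂ V'],
      ∀ φ : V →ₗ[A] V', Function.Surjective φ →
        Function.Surjective
          (whMap (Q := A ⧸ whIdeal A (Algebra.adjoin ℂ (Set.range f)) χ) φ)) ∧
    -- every finite-dimensional `U_ξ(𝔤)`-module is generated by its Whittaker vectors
    (∀ (V : Type) [AddCommGroup V] [Module ℂ V] [Module A V] [IsScalarTower ℂ A V]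
      [FiniteDimensional ℂ V],
      Submodule.span A
        {v : V | ∀ x : ↥(Algebra.adjoin ℂ (Set.range f)), (x : A) • v = χ x • v} = ⊤) := by
  clear hχ0 hχγ hfrob
  revert χ hfree
  generalize Algebra.adjoin ℂ (Set.range f) = M
  intro χ hfree hwhit
  have hlift : ∀ (V V' : Type) [AddCommGroup V] [Module ℂ V] [Module A V] [IsScalarTower ℂ A V]
      [FiniteDimensional ℂ V] [AddCommGroup V'] [Module ℂ V'] [Module A V']
      [IsScalarTower ℂ A V'] [FiniteDimensional ℂ V'],
      ∀ φ : V →ₗ[A] V', Function.Surjective φ → ∀ w ∈ whVectors M χ V',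
        ∃ v ∈ whVectors M χ V, φ v = w := by
    intro V V' _ _ _ _ _ _ _ _ _ _ φ hφ w hw
    have : FiniteDimensional ℂ (LinearMap.ker φ) :=
      inferInstanceAs (FiniteDimensional ℂ (LinearMap.ker (φ.restrictScalars ℂ)))
    exact exists_whVectors_lift χ φ hφ (hfree V) (hfree V') (hfree (LinearMap.ker φ)) hw
  have hgen : ∀ (V : Type) [AddCommGroup V] [Module ℂ V] [Module A V] [IsScalarTower ℂ A V]
      [FiniteDimensional ℂ V], Submodule.span A (whVectors M χ V : Set V) = ⊤ := by
    intro V _ _ _ _ _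
    by_contra hne
    set N := Submodule.span A (whVectors M χ V : Set V)
    have : Nontrivial (V ⧸ N) := Submodule.Quotient.nontrivial_iff.mpr hne
    have : FiniteDimensional ℂ (V ⧸ N) :=
      Module.Finite.of_surjective (N.mkQ.restrictScalars ℂ) N.mkQ_surjective
    obtain ⟨w, hw0, hw⟩ := hwhit (V ⧸ N)
    obtain ⟨v, hv, rfl⟩ := hlift V (V ⧸ N) N.mkQ N.mkQ_surjective w hw
    exact hw0 ((Submodule.Quotient.mk_eq_zero N).mpr (Submodule.subset_span hv))
  have hexact : ∀ (V V' : Type) [AddCommGroup V] [Module ℂ V] [Module A V] [IsScalarTower ℂ A V]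
      [FiniteDimensional ℂ V] [AddCommGroup V'] [Module ℂ V'] [Module A V']
      [IsScalarTower ℂ A V'] [FiniteDimensional ℂ V'],
      ∀ φ : V →ₗ[A] V', Function.Surjective φ →
        Function.Surjective (whMap (Q := A ⧸ whIdeal A M χ) φ) := by
    intro V V' _ _ _ _ _ _ _ _ _ _ φ hφ θ
    obtain ⟨v, hv, hvθ⟩ := hlift V V' φ hφ _ (hom_mk_one_mem_whVectors θ)
    obtain ⟨ψ, hψ⟩ := exists_hom_of_mem_whVectors hv
    exact ⟨ψ, hom_ext_mk_one (by rw [whMap_apply, LinearMap.comp_apply, hψ, hvθ])⟩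
  obtain ⟨s, hs⟩ := hexact A (A ⧸ whIdeal A M χ) (Submodule.mkQ _) (Submodule.mkQ_surjective _)
    LinearMap.id
  have hs' (q : A ⧸ whIdeal A M χ) :
      s q • (Submodule.Quotient.mk 1 : A ⧸ whIdeal A M χ) = q := by
    rw [← Submodule.Quotient.mk_smul, smul_eq_mul, mul_one]
    exact LinearMap.congr_fun hs q
  obtain ⟨n, a, v, hone⟩ := Submodule.mem_span_set'.mp
    (show (1 : A) ∈ Submodule.span A (whVectors M χ A : Set A) from hgen A ▸ Submodule.mem_top)
  choose ψ hψ using fun i => exists_hom_of_mem_whVectors (v i).2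
  have htrace : ∑ i, ψ i (a i • Submodule.Quotient.mk 1) = 1 := by
    simpa only [map_smul, hψ] using hone
  refine ⟨?_, ?_, hexact, hgen⟩
  · intro V V' _ _ _ _ _ _ _ _ _ _
    constructor
    · intro φ φ' h
      apply LinearMap.ext_on (hgen V)
      intro v hv
      obtain ⟨θ, rfl⟩ := exists_hom_of_mem_whVectors hv
      exact LinearMap.congr_fun (LinearMap.congr_fun h θ) _
    · intro T
      exact whMap_surjective_of_sum_eq_one htrace T
  · intro E _ _ hE
    exact exists_finDimRep_equiv hs' htrace
end

section
/- Under the standing hypotheses, the left U_ξ(𝔤)-module Q_χ = U_ξ(𝔤) ⊗_{U_ξ(𝔪_−)} ℂ_χ is projective in the category of finite-dimensional left U_ξ(𝔤)-modules, i.e. the functor Hom_{U_ξ(𝔤)}(Q_χ, ·) is exact on finite-dimensional U_ξ(𝔤)-modules. -/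
/-- A vector of `V` killed by all `y - χ(y)`, `y ∈ M`, is the image of the cyclic vector under
an `A`-linear map `Q_χ → V`. -/
theorem exists_linearMap_of_whittaker {A V : Type*} [Ring A] [Algebra ℂ A] [AddCommGroup V]
    [Module A V] {M : Subalgebra ℂ A} {χ : M →ₐ[ℂ] ℂ} {w : V}
    (hw : ∀ y : M, ((y : A) - algebraMap ℂ A (χ y)) • w = 0) :
    ∃ ψ : (A ⧸ whIdeal A M χ) →ₗ[A] V, ψ (Submodule.Quotient.mk 1) = w := by
  have hle : whIdeal A M χ ≤ LinearMap.ker (LinearMap.toSpanSingleton A V w) := by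
    refine Ideal.span_le.mpr ?_
    rintro _ ⟨y, rfl⟩
    simpa using hw y
  refine ⟨Submodule.liftQ _ _ hle, ?_⟩
  rw [Submodule.liftQ_apply, LinearMap.toSpanSingleton_apply, one_smul]

/-- The image of the cyclic vector of `Q_χ` is killed by all `y - χ(y)`, `y ∈ M`. -/
theorem whittaker_smul_apply_mk_one {A V : Type*} [Ring A] [Algebra ℂ A] [AddCommGroup V]
    [Module A V] {M : Subalgebra ℂ A} {χ : M →ₐ[ℂ] ℂ}
    (ψ : (A ⧸ whIdeal A M χ) →ₗ[A] V) (y : M) :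
    ((y : A) - algebraMap ℂ A (χ y)) • ψ (Submodule.Quotient.mk 1) = 0 := by
  have hmem : (y : A) - algebraMap ℂ A (χ y) ∈ whIdeal A M χ := Ideal.subset_span ⟨y, rfl⟩
  rw [← map_smul, ← Submodule.Quotient.mk_smul, smul_eq_mul, mul_one,
    (Submodule.Quotient.mk_eq_zero _).mpr hmem, map_zero]

/-- **Lemma 10.2 (projectivity of `Q_χ`).**
Standing hypotheses as in the Skryabin equivalence: `A = U_ξ(𝔤)` is the
finite-dimensional quotient of the quantum group at the primitive `m`-th root of unity
`ε` attached to `ξ = g̃η` with `φ∘π̃(ξ) ∈ μ_{M_+}^{-1}(u)` and all `t_i ≠ 0`;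
`M = U_ξ(𝔪_−)` is the Frobenius subalgebra generated by the root vectors `f_β`,
`β ∈ Δ_{𝔪_+}`, over which every finite-dimensional `U_ξ(𝔤)`-module is free (Theorem 9.1);
`χ` a character of `M`, `ℂ_χ` the corresponding one-dimensional module and
`Q_χ = U_ξ(𝔤) ⊗_{U_ξ(𝔪_−)} ℂ_χ` the induced left module.  Then `Q_χ` is projective in
the category of finite-dimensional left `U_ξ(𝔤)`-modules, i.e. the functor
`Hom_{U_ξ(𝔤)}(Q_χ, ·)` is exact on finite-dimensional `U_ξ(𝔤)`-modules. -/
theorem Qchi_projective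
    (m : ℕ) (hmodd : Odd m) (hm1 : 1 < m) (ε : ℂ) (hε : IsPrimitiveRoot ε m)
    (A : Type) [Ring A] [Algebra ℂ A] [FiniteDimensional ℂ A]
    (L l' : ℕ) (f : Fin L → A) (g : Fin l' → Fin L) (hginj : Function.Injective g)
    (dd : Fin l' → ℂ) (hdd : ∀ i, dd i ≠ 0)
    (hfγ : ∀ i, f (g i) ^ m = algebraMap ℂ A (dd i))
    (hf0 : ∀ k, k ∉ Set.range g → f k ^ m = 0)
    -- the character `χ` of `M = U_ξ(𝔪_−)`
    (χ : ↥(Algebra.adjoin ℂ (Set.range f)) →ₐ[ℂ] ℂ)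
    (c : Fin l' → ℂ) (hc : ∀ i, c i ^ m = dd i)
    (hχγ : ∀ i, χ ⟨f (g i), Algebra.subset_adjoin ⟨g i, rfl⟩⟩ = c i)
    (hχ0 : ∀ k, k ∉ Set.range g → χ ⟨f k, Algebra.subset_adjoin ⟨k, rfl⟩⟩ = 0)
    -- `M` is a Frobenius algebra (Proposition 8.1)
    (hfrob : IsFrobeniusAlgebra ℂ ↥(Algebra.adjoin ℂ (Set.range f)))
    -- every finite-dimensional `U_ξ(𝔤)`-module is free over `M` (Theorem 9.1)
    (hfree : ∀ (V : Type) [AddCommGroup V] [Module ℂ V] [Module A V]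
      [IsScalarTower ℂ A V] [FiniteDimensional ℂ V],
      ∃ (M' : ℕ) (v : Fin M' → V),
        (∀ w : V, ∃ cf : Fin M' → A,
          (∀ p, cf p ∈ Algebra.adjoin ℂ (Set.range f)) ∧ w = ∑ p, cf p • v p) ∧
        (∀ cf : Fin M' → A, (∀ p, cf p ∈ Algebra.adjoin ℂ (Set.range f)) →
          (∑ p, cf p • v p) = 0 → ∀ p, cf p = 0)) :
    ∀ (V V' : Type) [AddCommGroup V] [Module ℂ V] [Module A V] [IsScalarTower ℂ A V]
      [FiniteDimensional ℂ V] [AddCommGroup V'] [Module ℂ V'] [Module A V']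
      [IsScalarTower ℂ A V'] [FiniteDimensional ℂ V'],
      ∀ φ : V →ₗ[A] V', Function.Surjective φ →
        ∀ ψ' : (A ⧸ whIdeal A (Algebra.adjoin ℂ (Set.range f)) χ) →ₗ[A] V',
          ∃ ψ : (A ⧸ whIdeal A (Algebra.adjoin ℂ (Set.range f)) χ) →ₗ[A] V,
            φ ∘ₗ ψ = ψ' := by
  intro V V' _ _ _ _ _ _ _ _ _ _ φ hφ ψ'
  obtain ⟨n, v, hspan, hind⟩ := hfree V'
  obtain ⟨cf, hcf, hsum⟩ := hspan (ψ' (Submodule.Quotient.mk 1))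
  choose s hs using fun p => hφ (v p)
  have hw : ∀ y : Algebra.adjoin ℂ (Set.range f),
      ((y : A) - algebraMap ℂ A (χ y)) • ∑ p, cf p • s p = 0 := by
    intro y
    have hzero := whittaker_smul_apply_mk_one ψ' y
    rw [hsum, Finset.smul_sum] at hzero
    simp only [smul_smul] at hzero
    have hcoef := hind _ (fun p => mul_mem (sub_mem y.2 (Subalgebra.algebraMap_mem _ _)) (hcf p))
      hzero
    rw [Finset.smul_sum]
    exact Finset.sum_eq_zero fun p _ => by rw [smul_smul, hcoef p, zero_smul]
  obtain ⟨ψ, hψ⟩ := exists_linearMap_of_whittaker hw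
  refine ⟨ψ, Submodule.linearMap_qext _ (LinearMap.ext_ring ?_)⟩
  simp only [LinearMap.comp_apply, Submodule.mkQ_apply]
  rw [hψ, hsum, map_sum]
  simp only [map_smul, hs]
end

section
/- Under the standing hypotheses, the q-W algebra W_ε^s(G) is finite-dimensional, and dim W_ε^s(G) = m^{dim Σ_s}, where dim Σ_s = dim 𝔤 − 2 dim 𝔪_− is the dimension of the transversal slice Σ_s = sZN_s. -/
instance smulCommClass_of_tower (A V : Type*) [Ring A] [Algebra ℂ A] [AddCommGroup V]
    [Module ℂ V] [Module A V] [IsScalarTower ℂ A V] : SMulCommClass ℂ A V := by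
  constructor
  intro c a v
  rw [← IsScalarTower.algebraMap_smul A c v, ← IsScalarTower.algebraMap_smul A c (a • v),
    ← mul_smul, ← mul_smul, ← Algebra.commutes]

/-- The `χ`-Whittaker vectors of an `A`-module. -/
def whittakerVectors {A : Type*} [Ring A] [Algebra ℂ A] (M : Subalgebra ℂ A) (χ : M →ₐ[ℂ] ℂ)
    (V : Type*) [AddCommGroup V] [Module ℂ V] [Module A V] [IsScalarTower ℂ A V] :
    Submodule ℂ V where
  carrier := {v | ∀ x : M, (x : A) • v = χ x • v}
  add_mem' {v w} hv hw x := by rw [smul_add, smul_add, hv x, hw x]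
  zero_mem' x := by rw [smul_zero, smul_zero]
  smul_mem' t v hv x := by rw [← smul_comm t (x : A) v, hv x, smul_comm]

theorem mem_whittakerVectors {A : Type*} [Ring A] [Algebra ℂ A] {M : Subalgebra ℂ A}
    {χ : M →ₐ[ℂ] ℂ} {V : Type*} [AddCommGroup V] [Module ℂ V] [Module A V]
    [IsScalarTower ℂ A V] {v : V} :
    v ∈ whittakerVectors M χ V ↔ ∀ x : M, (x : A) • v = χ x • v :=
  Iff.rfl

/-- In a finite-dimensional Frobenius algebra, the `χ`-eigenvectors for left multiplication
form a line. -/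
theorem IsFrobeniusAlgebra.exists_eigenvector {M : Type*} [Ring M] [Algebra ℂ M]
    [FiniteDimensional ℂ M] (h : IsFrobeniusAlgebra ℂ M) (χ : M →ₐ[ℂ] ℂ) :
    ∃ y : M, y ≠ 0 ∧ (∀ x, x * y = χ x • y) ∧
      ∀ z, (∀ x, x * z = χ x • z) → ∃ t : ℂ, z = t • y := by
  obtain ⟨B, hassoc, -, hright⟩ := h
  have hinj : Function.Injective B.flip := by
    rw [← LinearMap.ker_eq_bot, LinearMap.ker_eq_bot']
    exact fun b hb => hright b fun a => LinearMap.congr_fun hb a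
  have hsurj : Function.Surjective B.flip :=
    (LinearMap.injective_iff_surjective_of_finrank_eq_finrank
      Subspace.dual_finrank_eq.symm).1 hinj
  obtain ⟨y, hy⟩ := hsurj χ.toLinearMap
  have hBy : ∀ a, B a y = χ a := fun a => LinearMap.congr_fun hy a
  refine ⟨y, ?_, fun x => ?_, fun z hz => ⟨B 1 z, ?_⟩⟩
  · rintro rfl
    simpa using hBy 1
  · refine hinj (LinearMap.ext fun a => ?_)
    simp only [LinearMap.flip_apply]
    rw [← hassoc, hBy, map_smul, hBy, map_mul, smul_eq_mul, mul_comm]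
  · refine hinj (LinearMap.ext fun a => ?_)
    simp only [LinearMap.flip_apply]
    rw [map_smul, hBy, ← one_mul a, hassoc, hz, map_smul, one_mul, smul_eq_mul, smul_eq_mul,
      mul_comm]

/-- For a module which is free over a Frobenius subalgebra `M`, the dimension of the space of
Whittaker vectors is the rank over `M`. -/
theorem finrank_whittakerVectors_mul {A : Type*} [Ring A] [Algebra ℂ A] [FiniteDimensional ℂ A]
    (M : Subalgebra ℂ A) (χ : M →ₐ[ℂ] ℂ) (hfrob : IsFrobeniusAlgebra ℂ M)
    (V : Type*) [AddCommGroup V] [Module ℂ V] [Module A V] [IsScalarTower ℂ A V]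
    {n : ℕ} (v : Fin n → V)
    (hspan : ∀ w : V, ∃ cf : Fin n → A, (∀ p, cf p ∈ M) ∧ w = ∑ p, cf p • v p)
    (hindep : ∀ cf : Fin n → A, (∀ p, cf p ∈ M) → (∑ p, cf p • v p) = 0 → ∀ p, cf p = 0) :
    Module.finrank ℂ (whittakerVectors M χ V) * Module.finrank ℂ M = Module.finrank ℂ V := by
  let F : (Fin n → M) →ₗ[ℂ] V :=
    { toFun := fun cf => ∑ p, (cf p : A) • v p
      map_add' := fun a b => by simp [add_smul, Finset.sum_add_distrib]
      map_smul' := fun t a => by simp [Finset.smul_sum, smul_assoc] }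
  have hFx : ∀ (x : M) (cf : Fin n → M), (x : A) • F cf = F (fun p => x * cf p) := by
    intro x cf
    simp [F, Finset.smul_sum, mul_smul]
  have hFinj : Function.Injective F := by
    rw [← LinearMap.ker_eq_bot, LinearMap.ker_eq_bot']
    intro cf hcf
    funext p
    exact Subtype.ext (hindep (fun p => cf p) (fun p => (cf p).2) hcf p)
  have hFsurj : Function.Surjective F := by
    intro w
    obtain ⟨cf, hcf, rfl⟩ := hspan w
    exact ⟨fun p => ⟨cf p, hcf p⟩, rfl⟩
  have hV : Module.finrank ℂ V = n * Module.finrank ℂ M := by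
    rw [← (LinearEquiv.ofBijective F ⟨hFinj, hFsurj⟩).finrank_eq, Module.finrank_pi_fintype]
    simp
  obtain ⟨y, hy0, hy, hyuniq⟩ := hfrob.exists_eigenvector χ
  let G : (Fin n → ℂ) →ₗ[ℂ] V :=
    F ∘ₗ LinearMap.pi fun p => (LinearMap.proj p).smulRight y
  have hGapp : ∀ t, G t = F (fun p => t p • y) := fun t => rfl
  have hGinj : Function.Injective G := by
    intro s t hst
    funext p
    exact smul_left_injective ℂ hy0 (congrFun (hFinj hst) p)
  have hGrange : LinearMap.range G = whittakerVectors M χ V := by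
    ext w
    constructor
    · rintro ⟨t, rfl⟩ x
      rw [hGapp, hFx, ← map_smul]
      congr 1
      funext p
      rw [mul_smul_comm, hy, Pi.smul_apply, smul_comm]
    · intro hw
      obtain ⟨cf, rfl⟩ := hFsurj w
      have hcf : ∀ p, ∃ t : ℂ, cf p = t • y := fun p => hyuniq _ fun x => by
        have hx := hw x
        rw [hFx, ← map_smul] at hx
        exact congrFun (hFinj hx) p
      choose t ht using hcf
      exact ⟨t, by rw [hGapp]; congr 1; funext p; exact (ht p).symm⟩
  rw [← hGrange, LinearMap.finrank_range_of_inj hGinj, hV]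
  simp

/-- The left action of `A` on its linear dual induced by right multiplication on `A`. -/
abbrev dualModule (A : Type*) [Ring A] [Algebra ℂ A] : Module A (Module.Dual ℂ A) :=
  Module.compHom (Module.Dual ℂ A)
    ({ toFun := fun a => (LinearMap.mulRight ℂ a).dualMap
       map_one' := by ext; simp
       map_mul' := fun a b => by ext; simp [mul_assoc]
       map_zero' := by ext; simp
       map_add' := fun a b => by ext; simp [mul_add] } : A →+* Module.End ℂ (Module.Dual ℂ A))

theorem dualModule_smul_apply {A : Type*} [Ring A] [Algebra ℂ A] (a : A) (φ : Module.Dual ℂ A)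
    (b : A) : (letI := dualModule A; a • φ) b = φ (b * a) :=
  rfl

theorem dualModule_isScalarTower (A : Type*) [Ring A] [Algebra ℂ A] :
    letI := dualModule A
    IsScalarTower ℂ A (Module.Dual ℂ A) := by
  letI := dualModule A
  refine ⟨fun t a φ => LinearMap.ext fun b => ?_⟩
  rw [LinearMap.smul_apply, dualModule_smul_apply, dualModule_smul_apply, mul_smul_comm, map_smul]

/-- The dual of `Q_χ` is the space of Whittaker vectors of the dual of `A`. -/
theorem finrank_whittakerVectors_dual {A : Type*} [Ring A] [Algebra ℂ A] [FiniteDimensional ℂ A]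
    (M : Subalgebra ℂ A) (χ : M →ₐ[ℂ] ℂ) :
    letI := dualModule A
    haveI := dualModule_isScalarTower A
    Module.finrank ℂ (whittakerVectors M χ (Module.Dual ℂ A)) =
      Module.finrank ℂ (A ⧸ whIdeal A M χ) := by
  letI := dualModule A
  haveI := dualModule_isScalarTower A
  have key : whittakerVectors M χ (Module.Dual ℂ A) =
      ((whIdeal A M χ).restrictScalars ℂ).dualAnnihilator := by
    ext φ
    rw [Submodule.mem_dualAnnihilator, mem_whittakerVectors]
    constructor
    · intro h w hw
      have hgen : ∀ a, φ (a * w) = 0 := by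
        rw [Submodule.restrictScalars_mem] at hw
        refine Submodule.span_induction (p := fun w _ => ∀ a, φ (a * w) = 0)
          ?_ ?_ ?_ ?_ hw
        · rintro _ ⟨y, rfl⟩ a
          have hya := LinearMap.congr_fun (h y) a
          rw [dualModule_smul_apply, LinearMap.smul_apply] at hya
          rw [mul_sub, map_sub, hya, ← Algebra.commutes, ← Algebra.smul_def, map_smul, sub_self]
        · intro a
          rw [mul_zero, map_zero]
        · intro x y _ _ hx hy a
          rw [mul_add, map_add, hx, hy, add_zero]
        · intro b x _ hx a
          rw [smul_eq_mul, ← mul_assoc, hx]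
      simpa using hgen 1
    · intro h x
      refine LinearMap.ext fun a => ?_
      have hmem : a * ((x : A) - algebraMap ℂ A (χ x)) ∈ (whIdeal A M χ).restrictScalars ℂ :=
        (whIdeal A M χ).mul_mem_left a (Ideal.subset_span ⟨x, rfl⟩)
      have hx := h _ hmem
      rw [mul_sub, map_sub, ← Algebra.commutes, ← Algebra.smul_def, map_smul, sub_eq_zero] at hx
      rw [dualModule_smul_apply, LinearMap.smul_apply, hx]
  rw [key, ← (Submodule.dualQuotEquivDualAnnihilator _).finrank_eq, Subspace.dual_finrank_eq,
    (Submodule.Quotient.restrictScalarsEquiv ℂ (whIdeal A M χ)).finrank_eq]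

/-- Frobenius reciprocity: endomorphisms of `Q_χ` correspond to its Whittaker vectors. -/
theorem finrank_end_quotient_whIdeal {A : Type*} [Ring A] [Algebra ℂ A] [FiniteDimensional ℂ A]
    (M : Subalgebra ℂ A) (χ : M →ₐ[ℂ] ℂ) :
    FiniteDimensional ℂ (Module.End A (A ⧸ whIdeal A M χ)) ∧
    Module.finrank ℂ (Module.End A (A ⧸ whIdeal A M χ)) =
      Module.finrank ℂ (whittakerVectors M χ (A ⧸ whIdeal A M χ)) := by
  let q : A → A ⧸ whIdeal A M χ := Submodule.Quotient.mk
  have hq : ∀ a : A, q a = a • q 1 := fun a => by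
    simp only [q]
    rw [← Submodule.Quotient.mk_smul, smul_eq_mul, mul_one]
  let E : Module.End A (A ⧸ whIdeal A M χ) →ₗ[ℂ] A ⧸ whIdeal A M χ :=
    { toFun := fun φ => φ (q 1)
      map_add' := fun _ _ => rfl
      map_smul' := fun _ _ => rfl }
  have hEinj : Function.Injective E := by
    intro φ ψ h
    refine LinearMap.ext fun w => ?_
    obtain ⟨a, rfl⟩ := Submodule.Quotient.mk_surjective _ w
    change φ (q a) = ψ (q a)
    rw [hq, map_smul, map_smul]
    exact congrArg (a • ·) h
  have hErange : LinearMap.range E = whittakerVectors M χ (A ⧸ whIdeal A M χ) := by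
    ext w
    constructor
    · rintro ⟨φ, rfl⟩ x
      have hx : (x : A) • q 1 = algebraMap ℂ A (χ x) • q 1 := by
        rw [← hq, ← hq]
        exact (Submodule.Quotient.eq _).2 (Ideal.subset_span ⟨x, rfl⟩)
      change (x : A) • φ (q 1) = χ x • φ (q 1)
      rw [← map_smul, hx, map_smul, algebraMap_smul]
    · intro hw
      have hle : whIdeal A M χ ≤ LinearMap.ker (LinearMap.toSpanSingleton A _ w) := by
        refine Submodule.span_le.2 ?_
        rintro _ ⟨y, rfl⟩
        simp only [SetLike.mem_coe, LinearMap.mem_ker, LinearMap.toSpanSingleton_apply]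
        rw [sub_smul, hw y, algebraMap_smul, sub_self]
      exact ⟨(whIdeal A M χ).liftQ _ hle, one_smul A w⟩
  exact ⟨FiniteDimensional.of_injective E hEinj,
    by rw [← hErange, LinearMap.finrank_range_of_inj hEinj]⟩

/-- **Corollary 10.4 (dimension of the q-W algebra).**
Standing hypotheses as in the Skryabin equivalence: `A = U_ξ(𝔤)` has dimension
`m^{dim 𝔤}` where `dim 𝔤 = 2·dim 𝔪_− + dim Σ_s` (`Σ_s = sZN_s` the transversal slice,
`L = dim 𝔪_− = |Δ_{𝔪_+}|`), the induced module `Q_χ = U_ξ(𝔤) ⊗_{U_ξ(𝔪_−)} ℂ_χ` has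
dimension `m^{dim 𝔤 − dim 𝔪_−}`, every finite-dimensional `U_ξ(𝔤)`-module is free over
the Frobenius subalgebra `M = U_ξ(𝔪_−)`, and every nonzero finite-dimensional module
contains a nonzero Whittaker vector.  Then the q-W algebra
`W_ε^s(G) = End_{U_ξ(𝔤)}(Q_χ)^{opp}` is finite-dimensional and
`dim W_ε^s(G) = m^{dim Σ_s}`. -/
theorem qW_algebra_dimension
    (m : ℕ) (hmodd : Odd m) (hm1 : 1 < m) (ε : ℂ) (hε : IsPrimitiveRoot ε m)
    (A : Type) [Ring A] [Algebra ℂ A] [FiniteDimensional ℂ A]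
    (dimg dimSigma L l' : ℕ)
    -- `dim 𝔤 = 2 dim 𝔪_− + dim Σ_s` (Theorem 7.7) and `dim U_ξ(𝔤) = m^{dim 𝔤}`
    (hDg : dimg = 2 * L + dimSigma) (hdimA : Module.finrank ℂ A = m ^ dimg)
    (f : Fin L → A) (g : Fin l' → Fin L) (hginj : Function.Injective g)
    (dd : Fin l' → ℂ) (hdd : ∀ i, dd i ≠ 0)
    (hfγ : ∀ i, f (g i) ^ m = algebraMap ℂ A (dd i))
    (hf0 : ∀ k, k ∉ Set.range g → f k ^ m = 0)
    -- the character `χ` of `M = U_ξ(𝔪_−)`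
    (χ : ↥(Algebra.adjoin ℂ (Set.range f)) →ₐ[ℂ] ℂ)
    (c : Fin l' → ℂ) (hc : ∀ i, c i ^ m = dd i)
    (hχγ : ∀ i, χ ⟨f (g i), Algebra.subset_adjoin ⟨g i, rfl⟩⟩ = c i)
    (hχ0 : ∀ k, k ∉ Set.range g → χ ⟨f k, Algebra.subset_adjoin ⟨k, rfl⟩⟩ = 0)
    (hfrob : IsFrobeniusAlgebra ℂ ↥(Algebra.adjoin ℂ (Set.range f)))
    -- `dim Q_χ = m^{dim 𝔤 − dim 𝔪_−}`
    (hQdim : Module.finrank ℂ (A ⧸ whIdeal A (Algebra.adjoin ℂ (Set.range f)) χ) =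
      m ^ (dimg - L))
    -- every finite-dimensional `U_ξ(𝔤)`-module is free over `M` (Theorem 9.1)
    (hfree : ∀ (V : Type) [AddCommGroup V] [Module ℂ V] [Module A V]
      [IsScalarTower ℂ A V] [FiniteDimensional ℂ V],
      ∃ (M' : ℕ) (v : Fin M' → V),
        (∀ w : V, ∃ cf : Fin M' → A,
          (∀ p, cf p ∈ Algebra.adjoin ℂ (Set.range f)) ∧ w = ∑ p, cf p • v p) ∧
        (∀ cf : Fin M' → A, (∀ p, cf p ∈ Algebra.adjoin ℂ (Set.range f)) →
          (∑ p, cf p • v p) = 0 → ∀ p, cf p = 0))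
    -- every nonzero finite-dimensional module contains a nonzero Whittaker vector
    (hwhit : ∀ (V : Type) [AddCommGroup V] [Module ℂ V] [Module A V]
      [IsScalarTower ℂ A V] [FiniteDimensional ℂ V] [Nontrivial V],
      ∃ v : V, v ≠ 0 ∧
        ∀ x : ↥(Algebra.adjoin ℂ (Set.range f)), (x : A) • v = χ x • v) :
    FiniteDimensional ℂ
      ((Module.End A (A ⧸ whIdeal A (Algebra.adjoin ℂ (Set.range f)) χ))ᵐᵒᵖ) ∧
    Module.finrank ℂ
      ((Module.End A (A ⧸ whIdeal A (Algebra.adjoin ℂ (Set.range f)) χ))ᵐᵒᵖ) =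
      m ^ dimSigma := by
  have hrank : ∀ (V : Type) [AddCommGroup V] [Module ℂ V] [Module A V]
      [IsScalarTower ℂ A V] [FiniteDimensional ℂ V],
      Module.finrank ℂ (whittakerVectors _ χ V) *
        Module.finrank ℂ (Algebra.adjoin ℂ (Set.range f)) = Module.finrank ℂ V := by
    intro V _ _ _ _ _
    obtain ⟨n, v, hspan, hindep⟩ := hfree V
    exact finrank_whittakerVectors_mul _ χ hfrob V v hspan hindep
  have hmpos : 0 < m := by omega
  have hM : Module.finrank ℂ (Algebra.adjoin ℂ (Set.range f)) = m ^ L := by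
    letI := dualModule A
    haveI := dualModule_isScalarTower A
    have h := hrank (Module.Dual ℂ A)
    rw [finrank_whittakerVectors_dual, hQdim, Subspace.dual_finrank_eq, hdimA] at h
    refine Nat.eq_of_mul_eq_mul_left (pow_pos hmpos (dimg - L)) ?_
    rw [h, ← pow_add]
    congr 1
    omega
  obtain ⟨hfin, hend⟩ := finrank_end_quotient_whIdeal (Algebra.adjoin ℂ (Set.range f)) χ
  refine ⟨Module.Finite.equiv (MulOpposite.opLinearEquiv ℂ), ?_⟩
  rw [← (MulOpposite.opLinearEquiv ℂ).finrank_eq, hend]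
  have h := hrank (A ⧸ whIdeal A (Algebra.adjoin ℂ (Set.range f)) χ)
  rw [hM, hQdim] at h
  refine Nat.eq_of_mul_eq_mul_right (pow_pos hmpos L) ?_
  rw [h, ← pow_add]
  congr 1
  omega
end
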